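/- arXiv:1801.06125 — 5 statements merged into one kernel-verified Lean document; each statement's English description precedes it below -/
import Mathlib

section
/- Let C be a monoidal category and suppose there exists a strong monoidal functor F from C to the Drinfeld center Z(C) together with a monoidal natural isomorphism between the composite of F with the forgetful functor Z(C) → C and the identity functor of C. Then C admits a braiding, i.e., there exists a braided monoidal category structure on C. (A section of the forgetful functor from the center gives rise to a braiding.) -/
open CategoryTheory MonoidalCategory

theorem aux_braiding
    {C : Type*} [Category C] [MonoidalCategory C]
    (G : C → C) (b : ∀ X, HalfBraiding (G X)) (i : ∀ X, G X ≅ X)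
    (m : ∀ X Y, G X ⊗ G Y ⟶ G (X ⊗ Y))
    (hm : ∀ X Y U, m X Y ▷ U ≫ ((b (X ⊗ Y)).β U).hom =
      ((α_ _ _ _).hom ≫ G X ◁ ((b Y).β U).hom ≫ (α_ _ _ _).inv ≫
        ((b X).β U).hom ▷ G Y ≫ (α_ _ _ _).hom) ≫ U ◁ m X Y)
    (hi : ∀ X Y, m X Y ≫ (i (X ⊗ Y)).hom = (i X).hom ⊗ₘ (i Y).hom)
    (g : ∀ {X Y : C} (_ : X ⟶ Y), G X ⟶ G Y)
    (hg : ∀ {X Y : C} (f : X ⟶ Y), g f ≫ (i Y).hom = (i X).hom ≫ f)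
    (hgb : ∀ {X Y : C} (f : X ⟶ Y) (U : C),
      g f ▷ U ≫ ((b Y).β U).hom = ((b X).β U).hom ≫ U ◁ g f) :
    Nonempty (BraidedCategory C) := by
  refine ⟨{
    braiding := fun X Y => whiskerRightIso (i X).symm Y ≪≫ (b X).β Y ≪≫ whiskerLeftIso Y (i X)
    braiding_naturality_right := ?_
    braiding_naturality_left := ?_
    hexagon_forward := ?_
    hexagon_reverse := ?_ }⟩
  · intro X Y Z f
    simp only [Iso.trans_hom, whiskerRightIso_hom, whiskerLeftIso_hom, Iso.symm_hom,
      Category.assoc]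
    rw [whisker_exchange_assoc, HalfBraiding.naturality_assoc, whisker_exchange]
  · intro X Y f Z
    simp only [Iso.trans_hom, whiskerRightIso_hom, whiskerLeftIso_hom, Iso.symm_hom,
      Category.assoc]
    have h : f ≫ (i Y).inv = (i X).inv ≫ g f := by
      rw [Iso.comp_inv_eq, Category.assoc, hg, Iso.inv_hom_id_assoc]
    rw [← comp_whiskerRight_assoc, h, comp_whiskerRight_assoc, reassoc_of% (hgb f Z),
      ← MonoidalCategory.whiskerLeft_comp, hg, MonoidalCategory.whiskerLeft_comp]
  · intro X Y Z
    simp only [Iso.trans_hom, whiskerRightIso_hom, whiskerLeftIso_hom, Iso.symm_hom,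
      Category.assoc, HalfBraiding.monoidal]
    calc
      _ = 𝟙 _ ⊗≫ (i X).inv ▷ Y ▷ Z ⊗≫ ((b X).β Y).hom ▷ Z ⊗≫ Y ◁ ((b X).β Z).hom ⊗≫
          Y ◁ Z ◁ (i X).hom ⊗≫ 𝟙 _ := by monoidal
      _ = 𝟙 _ ⊗≫ (i X).inv ▷ Y ▷ Z ⊗≫ ((b X).β Y).hom ▷ Z ⊗≫
          Y ◁ ((i X).hom ≫ (i X).inv) ▷ Z ⊗≫ Y ◁ ((b X).β Z).hom ⊗≫
          Y ◁ Z ◁ (i X).hom ⊗≫ 𝟙 _ := by rw [Iso.hom_inv_id]; monoidal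
      _ = _ := by monoidal
  · intro X Y Z
    simp only [Iso.trans_hom, whiskerRightIso_hom, whiskerLeftIso_hom, Iso.symm_hom,
      Category.assoc]
    have h : (i (X ⊗ Y)).inv = ((i X).inv ⊗ₘ (i Y).inv) ≫ m X Y := by
      rw [← cancel_mono (i (X ⊗ Y)).hom, Category.assoc, hi, Iso.inv_hom_id,
        tensorHom_comp_tensorHom, Iso.inv_hom_id, Iso.inv_hom_id, id_tensorHom_id]
    rw [h, comp_whiskerRight_assoc, reassoc_of% (hm X Y Z)]
    rw [← MonoidalCategory.whiskerLeft_comp_assoc, hi, tensorHom_def (i X).hom,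
      tensorHom_def' (i X).inv]
    calc
      _ = 𝟙 _ ⊗≫ X ◁ (i Y).inv ▷ Z ⊗≫ ((i X).inv ▷ (G Y ⊗ Z) ≫ G X ◁ ((b Y).β Z).hom) ⊗≫
          (((b X).β Z).hom ▷ G Y ⊗≫ Z ◁ (i X).hom ▷ G Y ⊗≫ ((Z ⊗ X) ◁ (i Y).hom)) ⊗≫ 𝟙 _ := by
            monoidal
      _ = 𝟙 _ ⊗≫ X ◁ (i Y).inv ▷ Z ⊗≫ X ◁ ((b Y).β Z).hom ⊗≫
          (((i X).inv ▷ Z ≫ ((b X).β Z).hom ≫ Z ◁ (i X).hom) ▷ G Y ≫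
            ((Z ⊗ X) ◁ (i Y).hom)) ⊗≫ 𝟙 _ := by
            rw [← whisker_exchange]; monoidal
      _ = _ := by rw [← whisker_exchange]; monoidal

/-- A section of the forgetful functor from the Drinfeld center gives rise to a
braiding: if there is a strong monoidal functor `F : C ⥤ Center C` together with
a monoidal natural isomorphism `F ⋙ forget ≅ 𝟭 C`, then `C` admits a braided
monoidal category structure. -/
theorem section_of_center_forget_gives_braiding
    (C : Type*) [Category C] [MonoidalCategory C]
    (F : C ⥤ CategoryTheory.Center C) [F.Monoidal]
    (e : F ⋙ CategoryTheory.Center.forget C ≅ 𝟭 C)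
    [NatTrans.IsMonoidal e.hom] :
    Nonempty (BraidedCategory C) := by
  refine aux_braiding (fun X => (F.obj X).1) (fun X => (F.obj X).2) (fun X => e.app X)
    (fun X Y => (Functor.LaxMonoidal.μ F X Y).f) ?_ ?_ (fun f => (F.map f).f) ?_ ?_
  · intro X Y U
    have := (Functor.LaxMonoidal.μ F X Y).comm U
    rw [Center.tensor_β] at this
    exact this
  · intro X Y
    have := NatTrans.IsMonoidal.tensor (τ := e.hom) X Y
    rw [Functor.LaxMonoidal.comp_μ, Center.forget_μ, Functor.LaxMonoidal.id_μ] at this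
    exact (congrArg (· ≫ e.hom.app (X ⊗ Y)) (Category.id_comp _)).symm.trans (this.trans (Category.comp_id _))
  · intro X Y f
    exact e.hom.naturality f
  · intro X Y f U
    exact (F.map f).comm U
end

section
/- Let G be a group, k a field, and μ a 2-cocycle on G with values in kˣ. Define ε_g(x) = μ(gxg⁻¹, g) · μ(g, x)⁻¹. Then for every g ∈ G, the restriction of the map x ↦ ε_g(x) to the centralizer C_G(g) = {x ∈ G : gx = xg} is a group homomorphism C_G(g) → kˣ; that is, if x and y both commute with g then ε_g(xy) = ε_g(x) · ε_g(y). -/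
/-- `ε_g(x) = μ(gxg⁻¹, g) · μ(g, x)⁻¹` for a 2-cocycle `μ` on `G` with values in `kˣ`. -/
def cocycleEps {G : Type*} [Group G] {k : Type*} [Field k]
    (μ : G → G → kˣ) (g x : G) : kˣ :=
  μ (g * x * g⁻¹) g * (μ g x)⁻¹

/-- For a 2-cocycle `μ` on `G` with values in `kˣ`, the map `x ↦ ε_g(x)` restricted
to the centralizer of `g` is multiplicative: if `x` and `y` both commute with `g`
then `ε_g(xy) = ε_g(x) · ε_g(y)`. -/
theorem cocycleEps_restrict_centralizer_hom {G : Type*} [Group G] {k : Type*} [Field k]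
    (μ : G → G → kˣ)
    (hμ : ∀ x y z : G, μ x y * μ (x * y) z = μ y z * μ x (y * z))
    (g x y : G) (hx : g * x = x * g) (hy : g * y = y * g) :
    cocycleEps μ g (x * y) = cocycleEps μ g x * cocycleEps μ g y := by
  have A := hμ x y g
  have B := hμ x g y
  have C := hμ g x y
  have hxy : g * (x * y) = x * y * g := by
    rw [← mul_assoc, hx, mul_assoc, hy, ← mul_assoc]
  unfold cocycleEps
  rw [hx, hy, hxy, mul_inv_cancel_right, mul_inv_cancel_right, mul_inv_cancel_right]
  rw [hy] at B
  rw [hx] at C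
  generalize μ x (y * g) = P at *
  generalize μ (x * g) y = Q at *
  generalize μ (x * y) g = a at *
  generalize μ g (x * y) = d at *
  generalize μ x y = m at *
  have hP : P = (μ g y)⁻¹ * (μ x g * Q) := by rw [B, inv_mul_cancel_left]
  have ha : a = m⁻¹ * (μ y g * P) := by rw [← A, inv_mul_cancel_left]
  have hd : d = m⁻¹ * (μ g x * Q) := by rw [C, inv_mul_cancel_left]
  rw [ha, hd, hP]
  ext
  push_cast
  field_simp
end

section
/- Let G be a group, k a field, and μ a 2-cocycle on G with values in kˣ. Define Alt(μ)(g, x) = μ(x, g) · μ(g, x)⁻¹. If g ∈ G commutes with both x ∈ G and y ∈ G, then Alt(μ)(g, xy) = Alt(μ)(g, x) · Alt(μ)(g, y). (Multiplicativity of Alt(μ) in the second argument on commuting pairs.) -/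
/-- `Alt(μ)(g, x) = μ(x, g) · μ(g, x)⁻¹` for a 2-cocycle `μ` on `G` with values in `kˣ`. -/
def cocycleAlt {G : Type*} [Group G] {k : Type*} [Field k]
    (μ : G → G → kˣ) (g x : G) : kˣ :=
  μ x g * (μ g x)⁻¹

/-- `Alt(μ)` is multiplicative in the second argument on commuting pairs: if `g`
commutes with both `x` and `y`, then `Alt(μ)(g, xy) = Alt(μ)(g, x) · Alt(μ)(g, y)`. -/
theorem cocycleAlt_mul_right {G : Type*} [Group G] {k : Type*} [Field k]
    (μ : G → G → kˣ)
    (hμ : ∀ x y z : G, μ x y * μ (x * y) z = μ y z * μ x (y * z))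
    (g x y : G) (hx : g * x = x * g) (hy : g * y = y * g) :
    cocycleAlt μ g (x * y) = cocycleAlt μ g x * cocycleAlt μ g y := by
  have h1 := hμ x y g
  have h2 := hμ x g y
  have h3 := hμ g x y
  rw [hx] at h3
  rw [hy] at h2
  unfold cocycleAlt
  generalize μ x y = a at *
  generalize μ (x * y) g = b at *
  generalize μ y g = c at *
  generalize μ x (y * g) = d at *
  generalize μ x g = e at *
  generalize μ (x * g) y = f at *
  generalize μ g y = p at *
  generalize μ g x = q at *
  generalize μ g (x * y) = r at *
  have key : b * (q * p) = e * c * r := by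
    apply mul_right_cancel (b := a * d * f)
    calc b * (q * p) * (a * d * f) = (a * b) * (p * d) * (q * f) := by
          simp only [mul_comm, mul_left_comm, mul_assoc]
      _ = (c * d) * (e * f) * (a * r) := by rw [h1, h2, h3]
      _ = e * c * r * (a * d * f) := by
          simp only [mul_comm, mul_left_comm, mul_assoc]
  rw [mul_mul_mul_comm, ← mul_inv, ← div_eq_mul_inv, ← div_eq_mul_inv, div_eq_div_iff_mul_eq_mul]
  exact key
end

section
/- Let G be a group, k a field, and μ a 2-cocycle on G with values in kˣ. Define Alt(μ)(g, x) = μ(x, g) · μ(g, x)⁻¹. If g ∈ G and h ∈ G both commute with x ∈ G, then Alt(μ)(gh, x) = Alt(μ)(g, x) · Alt(μ)(h, x). (Multiplicativity of Alt(μ) in the first argument on commuting pairs.) -/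
/-- `Alt(μ)` is multiplicative in the first argument on commuting pairs: if `g`
and `h` both commute with `x`, then `Alt(μ)(gh, x) = Alt(μ)(g, x) · Alt(μ)(h, x)`. -/
theorem cocycleAlt_mul_left {G : Type*} [Group G] {k : Type*} [Field k]
    (μ : G → G → kˣ)
    (hμ : ∀ x y z : G, μ x y * μ (x * y) z = μ y z * μ x (y * z))
    (g h x : G) (hg : g * x = x * g) (hh : h * x = x * h) :
    cocycleAlt μ (g * h) x = cocycleAlt μ g x * cocycleAlt μ h x := by
  have h1 := hμ x g h
  have h2 := hμ g x h
  have h3 := hμ g h x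
  rw [hg] at h2
  rw [hh] at h3
  unfold cocycleAlt
  have e1 : μ x (g * h) = (μ g h)⁻¹ * (μ x g * μ (x * g) h) := by
    rw [h1, inv_mul_cancel_left]
  have e2 : μ (x * g) h = (μ g x)⁻¹ * (μ x h * μ g (x * h)) := by
    rw [← h2, inv_mul_cancel_left]
  have e3 : μ (g * h) x = (μ g h)⁻¹ * (μ h x * μ g (x * h)) := by
    rw [← h3, inv_mul_cancel_left]
  rw [e1, e2, e3]
  simp only [mul_inv_rev, inv_inv]
  apply Units.ext
  push_cast
  field_simp
end

section
/- Let G be a group, k a field, and μ a 2-cocycle on G with values in kˣ. Define Alt(μ)(g, x) = μ(x, g) · μ(g, x)⁻¹. If g ∈ G commutes with x ∈ G, then for every a ∈ G one has Alt(μ)(a g a⁻¹, a x a⁻¹) = Alt(μ)(g, x). (Conjugation invariance of Alt(μ) on commuting pairs.) -/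
theorem cocycle_conj_aux {G : Type*} [Group G] {k : Type*} [Field k]
    (μ : G → G → kˣ)
    (hμ : ∀ x y z : G, μ x y * μ (x * y) z = μ y z * μ x (y * z))
    (g x g' x' a : G) (hx : x' * a = a * x) (hg : g' * a = a * g) :
    μ x' g' * μ (x' * g') a * (μ a x * μ a g) =
      (μ x' a * μ g' a) * (μ x g * μ a (x * g)) := by
  have h1 := hμ x' g' a
  have h2 := hμ x' a g
  have h3 := hμ a x g
  rw [hg] at h1
  rw [hx] at h2
  rw [h1, ← h3]
  calc μ g' a * μ x' (a * g) * (μ a x * μ a g)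
      = μ g' a * μ a x * (μ a g * μ x' (a * g)) := by
        simp only [mul_comm, mul_left_comm, mul_assoc]
    _ = _ := by
        rw [← h2]
        simp only [mul_comm, mul_left_comm, mul_assoc]

/-- `Alt(μ)` is conjugation invariant on commuting pairs: if `g` commutes with
`x`, then `Alt(μ)(aga⁻¹, axa⁻¹) = Alt(μ)(g, x)` for every `a ∈ G`. -/
theorem cocycleAlt_conj_invariant {G : Type*} [Group G] {k : Type*} [Field k]
    (μ : G → G → kˣ)
    (hμ : ∀ x y z : G, μ x y * μ (x * y) z = μ y z * μ x (y * z))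
    (g x : G) (hgx : g * x = x * g) (a : G) :
    cocycleAlt μ (a * g * a⁻¹) (a * x * a⁻¹) = cocycleAlt μ g x := by
  have hx : (a * x * a⁻¹) * a = a * x := by group
  have hg : (a * g * a⁻¹) * a = a * g := by group
  have hc : (a * g * a⁻¹) * (a * x * a⁻¹) = (a * x * a⁻¹) * (a * g * a⁻¹) := by
    have e1 : (a * g * a⁻¹) * (a * x * a⁻¹) = a * (g * x) * a⁻¹ := by group
    have e2 : (a * x * a⁻¹) * (a * g * a⁻¹) = a * (x * g) * a⁻¹ := by group
    rw [e1, e2, hgx]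
  have A := cocycle_conj_aux μ hμ g x _ _ a hx hg
  have B := cocycle_conj_aux μ hμ x g _ _ a hg hx
  rw [hc, hgx] at B
  unfold cocycleAlt
  generalize a * g * a⁻¹ = g' at *
  generalize a * x * a⁻¹ = x' at *
  rw [← div_eq_mul_inv, ← div_eq_mul_inv, div_eq_div_iff_mul_eq_mul]
  apply mul_right_cancel (b := μ (x' * g') a * (μ a x * μ a g) * (μ x' a * μ g' a * μ a (x * g)))
  have C := congrArg₂ (· * ·) A B.symm
  simp only [mul_comm, mul_left_comm, mul_assoc] at C ⊢
  exact C
end
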